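/- Let k be a field of characteristic different from 2 and let (α,β,γ) ∈ k³ (in particular this covers every four-dimensional Sklyanin algebra S(α,β,γ)). Then there do not exist a k-algebra endomorphism ν of A(α,β,γ) and a k-linear map ∂ : A(α,β,γ) → A(α,β,γ) such that ∂(x₀) = 1, ∂(x₁) = ∂(x₂) = ∂(x₃) = 0, and ∂(ab) = ∂(a)·b + ν(a)·∂(b) for all a, b ∈ A(α,β,γ). -/

import Mathlib

noncomputable section

variable (k : Type*) [Field k]

/-- The generators `x₀, x₁, x₂, x₃` of the free algebra `k⟨x₀,x₁,x₂,x₃⟩`. -/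
def g4 (i : Fin 4) : FreeAlgebra k (Fin 4) := FreeAlgebra.ι k i

/-- The relation whose induced ring quotient is the quotient of `k⟨x₀,x₁,x₂,x₃⟩` by the
two-sided ideal generated by the six defining elements of `A(α,β,γ)`. -/
def fourRel (α β γ : k) : FreeAlgebra k (Fin 4) → FreeAlgebra k (Fin 4) → Prop := fun a b =>
  b = 0 ∧
    (a = g4 k 0 * g4 k 1 - g4 k 1 * g4 k 0
          - algebraMap k _ α * (g4 k 2 * g4 k 3 + g4 k 3 * g4 k 2) ∨
     a = g4 k 0 * g4 k 1 + g4 k 1 * g4 k 0 - (g4 k 2 * g4 k 3 - g4 k 3 * g4 k 2) ∨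
     a = g4 k 0 * g4 k 2 - g4 k 2 * g4 k 0
          - algebraMap k _ β * (g4 k 3 * g4 k 1 + g4 k 1 * g4 k 3) ∨
     a = g4 k 0 * g4 k 2 + g4 k 2 * g4 k 0 - (g4 k 3 * g4 k 1 - g4 k 1 * g4 k 3) ∨
     a = g4 k 0 * g4 k 3 - g4 k 3 * g4 k 0
          - algebraMap k _ γ * (g4 k 1 * g4 k 2 + g4 k 2 * g4 k 1) ∨
     a = g4 k 0 * g4 k 3 + g4 k 3 * g4 k 0 - (g4 k 1 * g4 k 2 - g4 k 2 * g4 k 1))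

/-- The algebra `A(α,β,γ)`; when `α+β+γ+αβγ = 0` this is the four-dimensional Sklyanin
algebra `S(α,β,γ)`. -/
abbrev SklyA (α β γ : k) : Type _ := RingQuot (fourRel k α β γ)

/-- The images of the generators `x₀, x₁, x₂, x₃` in `A(α,β,γ)`. -/
def agen (α β γ : k) (i : Fin 4) : SklyA k α β γ :=
  RingQuot.mkAlgHom k (fourRel k α β γ) (g4 k i)

/-- The character of `A(α,β,γ)` sending `x₁` to `1` and the other generators to `0`. -/
def charX1 (α β γ : k) : SklyA k α β γ →ₐ[k] k :=
  RingQuot.liftAlgHom k ⟨FreeAlgebra.lift k (Pi.single 1 1), by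
    rintro a b ⟨rfl, rfl | rfl | rfl | rfl | rfl | rfl⟩ <;> simp [g4]⟩

theorem agen_one_ne_zero (α β γ : k) : agen k α β γ 1 ≠ 0 := by
  intro h
  have h1 : charX1 k α β γ (agen k α β γ 1) = 1 := by
    simp [charX1, agen, g4]
  rw [h, map_zero] at h1
  exact zero_ne_one h1

theorem agen_commutator_zero_one (α β γ : k) :
    agen k α β γ 0 * agen k α β γ 1 - agen k α β γ 1 * agen k α β γ 0
      = α • (agen k α β γ 2 * agen k α β γ 3 + agen k α β γ 3 * agen k α β γ 2) := by
  have h := RingQuot.mkAlgHom_rel k (s := fourRel k α β γ) ⟨rfl, Or.inl rfl⟩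
  simp only [map_sub, map_add, map_mul, map_zero, AlgHom.commutes] at h
  rw [Algebra.smul_def]
  exact sub_eq_zero.mp h

theorem agen_anticommutator_zero_one (α β γ : k) :
    agen k α β γ 0 * agen k α β γ 1 + agen k α β γ 1 * agen k α β γ 0
      = agen k α β γ 2 * agen k α β γ 3 - agen k α β γ 3 * agen k α β γ 2 := by
  have h := RingQuot.mkAlgHom_rel k (s := fourRel k α β γ) ⟨rfl, Or.inr (Or.inl rfl)⟩
  simp only [map_sub, map_add, map_mul, map_zero] at h
  exact sub_eq_zero.mp h

/-- There is no algebra endomorphism `ν` of `A(α,β,γ)` together with a `ν`-twisted derivation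
`D` with `D x₀ = 1` and `D x₁ = D x₂ = D x₃ = 0`. -/
theorem sklyanin4_no_twisted_derivation (hchar : ringChar k ≠ 2) (α β γ : k) :
    ¬ ∃ (ν : SklyA k α β γ →ₐ[k] SklyA k α β γ)
        (D : SklyA k α β γ →ₗ[k] SklyA k α β γ),
      D (agen k α β γ 0) = 1 ∧ D (agen k α β γ 1) = 0 ∧
      D (agen k α β γ 2) = 0 ∧ D (agen k α β γ 3) = 0 ∧
      ∀ a b : SklyA k α β γ, D (a * b) = D a * b + ν a * D b := by
  rintro ⟨ν, D, h0, h1, h2, h3, hD⟩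
  have hc := congrArg D (agen_commutator_zero_one k α β γ)
  have ha := congrArg D (agen_anticommutator_zero_one k α β γ)
  simp only [map_sub, map_add, map_smul, hD, h0, h1, h2, h3, one_mul, mul_one, mul_zero,
    zero_mul, add_zero, zero_add, sub_zero, smul_zero] at hc ha
  have htwo : (2 : k) • agen k α β γ 1 = 0 := by
    rw [two_smul]
    nth_rewrite 2 [sub_eq_zero.mp hc]
    exact ha
  exact (smul_eq_zero.mp htwo).elim (Ring.two_ne_zero hchar) (agen_one_ne_zero k α β γ)
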